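/- For all nonnegative integers a and b, the multiple zeta value ζ(2,…,2,3,2,…,2) with a twos before the 3 and b twos after the 3 satisfies ζ(2,…,2,3,2,…,2) = 2·∑_{r=1}^{a+b+1} (-1)^r · c_{a,b}^r · ζ(2r+1) · ζ(2,…,2) (with a+b+1−r twos), where c_{a,b}^r = C(2r, 2a+2) − (1 − 1/2^{2r})·C(2r, 2b+1) and C(n,k) denotes the binomial coefficient. -/

import Mathlib

open scoped BigOperators

/-- The multiple zeta value `ζ(k 0, …, k (n-1))`, defined as the sum of
`1 / (m 0 ^ k 0 ⋯ m (n-1) ^ k (n-1))` over all strictly increasing `n`-tuples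
of positive integers. -/
noncomputable def mzv {n : ℕ} (k : Fin n → ℕ) : ℝ :=
  ∑' m : Fin n → ℕ+, if StrictMono m then ∏ i, (1 : ℝ) / ((m i : ℕ) : ℝ) ^ (k i) else 0

/-- The Riemann zeta value `ζ(k)` as a real series. -/
noncomputable def riemannZetaReal (k : ℕ) : ℝ := ∑' n : ℕ+, (1 : ℝ) / ((n : ℕ) : ℝ) ^ k

open MeasureTheory Filter Topology Real

/-- The sum defining a multiple zeta value, restricted to tuples with all entries `> N` and taken
in `[0, ∞]`. -/
noncomputable def mzvTail {n : ℕ} (k : Fin n → ℕ) (N : ℕ) : ENNReal :=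
  ∑' m : Fin n → ℕ+, if StrictMono m ∧ ∀ i, N < (m i : ℕ) then
    ∏ i, ENNReal.ofReal (1 / ((m i : ℕ) : ℝ) ^ (k i)) else 0

lemma toReal_mzvTail_zero {n : ℕ} (k : Fin n → ℕ) : (mzvTail k 0).toReal = mzv k := by
  unfold mzvTail mzv
  rw [ENNReal.tsum_toReal_eq]
  · refine tsum_congr fun m => ?_
    by_cases h : StrictMono m
    · rw [if_pos ⟨h, fun i => (m i).pos⟩, if_pos h, ENNReal.toReal_prod]
      exact Finset.prod_congr rfl fun i _ => ENNReal.toReal_ofReal (by positivity)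
    · rw [if_neg (fun h' => h h'.1), if_neg h, ENNReal.toReal_zero]
  · intro m
    split_ifs
    · exact ENNReal.prod_ne_top fun i _ => ENNReal.ofReal_ne_top
    · exact ENNReal.zero_ne_top

lemma mzvTail_fin_zero (k : Fin 0 → ℕ) (N : ℕ) : mzvTail k N = 1 := by
  unfold mzvTail
  rw [tsum_eq_single (default : Fin 0 → ℕ+) (fun m hm => absurd (Subsingleton.elim m _) hm)]
  simp [Subsingleton.strictMono]

lemma tsum_pnat_ite_lt (N : ℕ) (f : ℕ → ENNReal) :
    ∑' x : ℕ+, (if N < (x : ℕ) then f x else 0) = ∑' x : ℕ, if N < x then f x else 0 := by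
  rw [tsum_pnat_eq_tsum_succ (f := fun x : ℕ => if N < x then f x else 0)]
  conv_rhs => rw [tsum_eq_zero_add' ENNReal.summable]
  simp

lemma strictMono_cons_and_lt_iff {n : ℕ} (x : ℕ+) (m : Fin n → ℕ+) (N : ℕ) :
    (StrictMono (Fin.cons x m : Fin (n + 1) → ℕ+) ∧
      ∀ i, N < ((Fin.cons x m : Fin (n + 1) → ℕ+) i : ℕ)) ↔
      N < (x : ℕ) ∧ StrictMono m ∧ ∀ i, (x : ℕ) < (m i : ℕ) := by
  constructor
  · rintro ⟨hm, hN⟩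
    refine ⟨by simpa using hN 0, fun i j hij => ?_, fun i => ?_⟩
    · simpa using hm (Fin.succ_lt_succ_iff.2 hij)
    · simpa using hm (Fin.succ_pos i)
  · rintro ⟨hN, hm, hx⟩
    refine ⟨fun i j hij => ?_, fun i => ?_⟩
    · induction j using Fin.cases with
      | zero => exact absurd hij (Fin.not_lt_zero i)
      | succ j =>
        induction i using Fin.cases with
        | zero => simpa using hx j
        | succ i => simpa using hm (Fin.succ_lt_succ_iff.1 hij)
    · induction i using Fin.cases with
      | zero => simpa using hN
      | succ i => simpa using hN.trans (hx i)

lemma mzvTail_succ {n : ℕ} (k : Fin (n + 1) → ℕ) (N : ℕ) :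
    mzvTail k N = ∑' x : ℕ, if N < x then
      ENNReal.ofReal (1 / (x : ℝ) ^ k 0) * mzvTail (Fin.tail k) x else 0 := by
  rw [← tsum_pnat_ite_lt]
  unfold mzvTail
  rw [← (Fin.consEquiv fun _ : Fin (n + 1) => ℕ+).tsum_eq, ENNReal.tsum_prod']
  refine tsum_congr fun x => ?_
  split_ifs with hx
  · rw [← ENNReal.tsum_mul_left]
    refine tsum_congr fun m => ?_
    have e : (Fin.consEquiv fun _ : Fin (n + 1) => ℕ+) (x, m) = Fin.cons x m := rfl
    rw [e]
    simp only [strictMono_cons_and_lt_iff x m N, hx, true_and, mul_ite, mul_zero,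
      Fin.prod_univ_succ, Fin.cons_zero, Fin.cons_succ, Fin.tail]
  · exact ENNReal.tsum_eq_zero.2 fun m =>
      if_neg fun h => hx ((strictMono_cons_and_lt_iff x m N).1 h).1

lemma tsum_mul_tsum_ite_lt (A B : ℕ → ENNReal) :
    ∑' n, A n * ∑' m, (if n < m then B m else 0) = ∑' m, (∑ n ∈ Finset.range m, A n) * B m := by
  simp only [← ENNReal.tsum_mul_left]
  rw [ENNReal.tsum_comm]
  refine tsum_congr fun m => ?_
  rw [Finset.sum_mul, tsum_eq_sum (s := Finset.range m)]
  · exact Finset.sum_congr rfl fun n hn => by rw [if_pos (Finset.mem_range.1 hn)]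
  · intro n hn
    rw [if_neg (by simpa using hn), mul_zero]

/-- The truncated multiple zeta value `∑ 1 / (m₁ ^ 2 ⋯ m_a ^ 2)` over `0 < m₁ < ⋯ < m_a < n`. -/
noncomputable def truncTwos : ℕ → ℕ → ℝ
  | 0, _ => 1
  | a + 1, n => ∑ m ∈ Finset.range n, truncTwos a m * (1 / (m : ℝ) ^ 2)

lemma truncTwos_nonneg (a n : ℕ) : 0 ≤ truncTwos a n := by
  induction a generalizing n with
  | zero => simp [truncTwos]
  | succ a ih => exact Finset.sum_nonneg fun m _ => mul_nonneg (ih m) (by positivity)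

lemma tsum_truncTwos_mzvTail_shift (c a n : ℕ) :
    ∑' x : ℕ, ENNReal.ofReal (truncTwos c x * (1 / (x : ℝ) ^ 2)) *
        mzvTail (fun i : Fin (n + 1) => if (i : ℕ) = a + 1 then 3 else 2) x =
      ∑' x : ℕ, ENNReal.ofReal (truncTwos (c + 1) x * (1 / (x : ℝ) ^ 2)) *
        mzvTail (fun i : Fin n => if (i : ℕ) = a then 3 else 2) x := by
  simp only [mzvTail_succ]
  rw [tsum_mul_tsum_ite_lt]
  refine tsum_congr fun m => ?_
  have : Fin.tail (fun i : Fin (n + 1) => if (i : ℕ) = a + 1 then 3 else 2) =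
      fun i : Fin n => if (i : ℕ) = a then 3 else 2 := by
    funext i; simp [Fin.tail]
  rw [this, ← ENNReal.ofReal_sum_of_nonneg
    (fun x _ => mul_nonneg (truncTwos_nonneg c x) (by positivity)), ← mul_assoc,
    ENNReal.ofReal_mul (truncTwos_nonneg _ _)]
  simp [truncTwos]

lemma tsum_truncTwos_mzvTail (c a b : ℕ) :
    ∑' x : ℕ, ENNReal.ofReal (truncTwos c x * (1 / (x : ℝ) ^ 2)) *
        mzvTail (fun i : Fin (a + b + 1) => if (i : ℕ) = a then 3 else 2) x =
      ∑' x : ℕ, ENNReal.ofReal (truncTwos (c + a + 1) x * (1 / (x : ℝ) ^ 3)) *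
        mzvTail (fun _ : Fin b => 2) x := by
  obtain ⟨n, hn⟩ : ∃ n, n = a + b := ⟨_, rfl⟩
  rw [← hn]
  induction a generalizing c n with
  | zero =>
    obtain rfl : n = b := by omega
    simp only [mzvTail_succ]
    rw [tsum_mul_tsum_ite_lt]
    refine tsum_congr fun m => ?_
    have : Fin.tail (fun i : Fin (n + 1) => if (i : ℕ) = 0 then 3 else 2) =
        fun i : Fin n => 2 := by
      funext i; simp [Fin.tail]
    rw [this, ← ENNReal.ofReal_sum_of_nonneg
      (fun x _ => mul_nonneg (truncTwos_nonneg c x) (by positivity)), ← mul_assoc,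
      ENNReal.ofReal_mul (truncTwos_nonneg _ _)]
    simp [truncTwos]
  | succ a ih =>
    obtain ⟨n, rfl⟩ : ∃ k, n = k + 1 := ⟨a + b, by omega⟩
    rw [tsum_truncTwos_mzvTail_shift, ih (c + 1) n (by omega)]
    simp only [show c + 1 + a + 1 = c + (a + 1) + 1 by ring]

lemma mzvTail_three_eq_tsum (a b : ℕ) :
    mzvTail (fun i : Fin (a + b + 1) => if (i : ℕ) = a then 3 else 2) 0 =
      ∑' x : ℕ, ENNReal.ofReal (truncTwos a x * (1 / (x : ℝ) ^ 3)) *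
        mzvTail (fun _ : Fin b => 2) x := by
  have key : ∀ f : ℕ → ENNReal, f 0 = 0 → (∑' x : ℕ, if 0 < x then f x else 0) = ∑' x, f x := by
    intro f hf
    refine tsum_congr fun x => ?_
    rcases Nat.eq_zero_or_pos x with rfl | hx
    · simp [hf]
    · rw [if_pos hx]
  cases a with
  | zero =>
    obtain ⟨n, hn⟩ : ∃ n, n = 0 + b := ⟨_, rfl⟩
    rw [← hn]
    obtain rfl : n = b := by omega
    have : Fin.tail (fun i : Fin (n + 1) => if (i : ℕ) = 0 then 3 else 2) =
        fun i : Fin n => 2 := by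
      funext i; simp [Fin.tail]
    rw [mzvTail_succ, this, key _ (by simp)]
    simp [truncTwos]
  | succ a =>
    have h := tsum_truncTwos_mzvTail 0 a b
    obtain ⟨n, hn⟩ : ∃ n, n = a + b + 1 := ⟨_, rfl⟩
    rw [← hn] at h
    rw [show a + 1 + b = n by omega]
    have ht : Fin.tail (fun i : Fin (n + 1) => if (i : ℕ) = a + 1 then 3 else 2) =
        fun i : Fin n => if (i : ℕ) = a then 3 else 2 := by
      funext i; simp [Fin.tail]
    rw [mzvTail_succ, ht, key _ (by simp)]
    simpa [truncTwos] using h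

/-- The divided power `(2 * x) ^ n / n!`. -/
noncomputable def dividedPow (n : ℕ) (x : ℝ) : ℝ := (2 * x) ^ n / n.factorial

lemma dividedPow_zero (x : ℝ) : dividedPow 0 x = 1 := by simp [dividedPow]

lemma dividedPow_succ_apply_zero (n : ℕ) : dividedPow (n + 1) 0 = 0 := by simp [dividedPow]

lemma dividedPow_nonneg (n : ℕ) {x : ℝ} (hx : 0 ≤ x) : 0 ≤ dividedPow n x := by
  unfold dividedPow; positivity

lemma continuous_dividedPow (n : ℕ) : Continuous (dividedPow n) := by
  unfold dividedPow; fun_prop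

lemma hasDerivAt_dividedPow_succ (n : ℕ) (x : ℝ) :
    HasDerivAt (dividedPow (n + 1)) (2 * dividedPow n x) x := by
  have h := ((((hasDerivAt_id x).const_mul 2).pow (n + 1)).div_const ((n + 1).factorial : ℝ))
  refine h.congr_deriv ?_
  have : ((n.factorial : ℝ)) ≠ 0 := by positivity
  simp only [dividedPow, Nat.factorial_succ, id]
  push_cast
  field_simp

lemma hasDerivAt_cos_pow (n : ℕ) (x : ℝ) :
    HasDerivAt (fun x => cos x ^ (n + 1)) (-((n + 1 : ℝ) * cos x ^ n * sin x)) x := by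
  refine ((hasDerivAt_cos x).pow (n + 1)).congr_deriv ?_
  push_cast; simp

lemma hasDerivAt_cos_pow_mul_sin (n : ℕ) (x : ℝ) :
    HasDerivAt (fun x => cos x ^ (2 * n + 1) * sin x)
      ((2 * n + 2) * cos x ^ (2 * (n + 1)) - (2 * n + 1) * cos x ^ (2 * n)) x := by
  refine ((hasDerivAt_cos_pow (2 * n) x).mul (hasDerivAt_sin x)).congr_deriv ?_
  push_cast
  have := sin_sq_add_cos_sq x
  have h2 : sin x ^ 2 = 1 - cos x ^ 2 := by linarith
  linear_combination (-(2 * n + 1) * cos x ^ (2 * n)) * h2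

/-- The even cosine moment `∫₀^{π/2} (2x)^{2b} / (2b)! · cos^{2n} x dx`. -/
noncomputable def cosMoment (b n : ℕ) : ℝ :=
  ∫ x in (0 : ℝ)..(π / 2), dividedPow (2 * b) x * cos x ^ (2 * n)

lemma intervalIntegrable_dividedPow_mul_cos (b n : ℕ) :
    IntervalIntegrable (fun x => dividedPow b x * cos x ^ n) volume 0 (π / 2) :=
  ((continuous_dividedPow b).mul (by fun_prop)).intervalIntegrable _ _

lemma cosMoment_zero_succ (n : ℕ) :
    (2 * n + 2) * cosMoment 0 (n + 1) = (2 * n + 1) * cosMoment 0 n := by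
  have h := intervalIntegral.integral_eq_sub_of_hasDerivAt (a := 0) (b := π / 2)
    (fun x _ => hasDerivAt_cos_pow_mul_sin n x)
    (Continuous.intervalIntegrable (by fun_prop) _ _)
  rw [intervalIntegral.integral_sub (Continuous.intervalIntegrable (by fun_prop) _ _)
    (Continuous.intervalIntegrable (by fun_prop) _ _), intervalIntegral.integral_const_mul,
    intervalIntegral.integral_const_mul] at h
  simp only [cos_pi_div_two, sin_zero] at h
  simp only [cosMoment, Nat.mul_zero, dividedPow_zero, one_mul]
  have h0 : (0 : ℝ) ^ (2 * n + 1) = 0 := by simp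
  rw [h0] at h
  linarith

lemma cosMoment_succ_succ (b n : ℕ) :
    (2 * n + 1) * cosMoment (b + 1) n - (2 * n + 2) * cosMoment (b + 1) (n + 1) =
      2 / (n + 1) * cosMoment b (n + 1) := by
  have hn : (n + 1 : ℝ) ≠ 0 := by positivity
  have hd : ∀ x, HasDerivAt (fun x => dividedPow (2 * b + 2) x * (cos x ^ (2 * n + 1) * sin x) +
      1 / (n + 1) * (dividedPow (2 * b + 1) x * cos x ^ (2 * n + 1 + 1)))
      ((2 * n + 2) * (dividedPow (2 * (b + 1)) x * cos x ^ (2 * (n + 1))) -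
       (2 * n + 1) * (dividedPow (2 * (b + 1)) x * cos x ^ (2 * n)) +
       2 / (n + 1) * (dividedPow (2 * b) x * cos x ^ (2 * (n + 1)))) x := by
    intro x
    refine (((hasDerivAt_dividedPow_succ (2 * b + 1) x).mul
      (hasDerivAt_cos_pow_mul_sin n x)).add
      (((hasDerivAt_dividedPow_succ (2 * b) x).mul
        (hasDerivAt_cos_pow (2 * n + 1) x)).const_mul _)).congr_deriv ?_
    rw [show 2 * (b + 1) = 2 * b + 1 + 1 by ring, show 2 * (n + 1) = 2 * n + 1 + 1 by ring]
    push_cast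
    field_simp
    ring
  have hi : ∀ (c : ℝ) (b n : ℕ), IntervalIntegrable
      (fun x => c * (dividedPow b x * cos x ^ n)) volume 0 (π / 2) :=
    fun c b n => (intervalIntegrable_dividedPow_mul_cos b n).const_mul c
  have h := intervalIntegral.integral_eq_sub_of_hasDerivAt (a := 0) (b := π / 2)
    (fun x _ => hd x) (((hi _ _ _).sub (hi _ _ _)).add (hi _ _ _))
  rw [intervalIntegral.integral_add ((hi _ _ _).sub (hi _ _ _)) (hi _ _ _),
    intervalIntegral.integral_sub (hi _ _ _) (hi _ _ _), intervalIntegral.integral_const_mul,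
    intervalIntegral.integral_const_mul, intervalIntegral.integral_const_mul] at h
  simp only [cos_pi_div_two, sin_zero, dividedPow_succ_apply_zero] at h
  have h0 : (0 : ℝ) ^ (2 * n + 1) = 0 := by simp
  have h1 : (0 : ℝ) ^ (2 * n + 1 + 1) = 0 := by simp
  rw [h0, h1] at h
  unfold cosMoment
  linarith

/-- The factor normalising the cosine moments so that the zeroth one is `1`. -/
noncomputable def momentScale (n : ℕ) : ℝ := 2 * 4 ^ n / (π * n.centralBinom)

lemma momentScale_pos (n : ℕ) : 0 < momentScale n := by
  have := n.centralBinom_pos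
  unfold momentScale; positivity

lemma momentScale_succ (n : ℕ) :
    (2 * n + 1) * momentScale (n + 1) = (2 * n + 2) * momentScale n := by
  have h : ((n : ℝ) + 1) * (n + 1).centralBinom = 2 * (2 * n + 1) * n.centralBinom := by
    exact_mod_cast n.succ_mul_centralBinom_succ
  have h1 : (n.centralBinom : ℝ) ≠ 0 := by exact_mod_cast n.centralBinom_ne_zero
  have h2 : ((n + 1).centralBinom : ℝ) ≠ 0 := by exact_mod_cast (n + 1).centralBinom_ne_zero
  unfold momentScale
  rw [pow_succ]
  field_simp
  linear_combination (-2) * h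

lemma momentScale_mul_cosMoment_zero (n : ℕ) : momentScale n * cosMoment 0 n = 1 := by
  induction n with
  | zero => simp [momentScale, cosMoment, dividedPow_zero]
  | succ n ih =>
    have h1 := momentScale_succ n
    have h2 := cosMoment_zero_succ n
    have h3 : (2 * n + 1 : ℝ) * (2 * n + 2) ≠ 0 := by positivity
    apply mul_left_cancel₀ h3
    linear_combination (2 * n + 2) * cosMoment 0 (n + 1) * h1 +
      (2 * n + 2) * momentScale n * h2 + (2 * n + 1) * (2 * n + 2) * ih

lemma scaled_cosMoment_sub (b n : ℕ) :
    momentScale n * cosMoment (b + 1) n - momentScale (n + 1) * cosMoment (b + 1) (n + 1) =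
      1 / ((n + 1 : ℕ) : ℝ) ^ 2 * (momentScale (n + 1) * cosMoment b (n + 1)) := by
  have h1 := momentScale_succ n
  have h2 := cosMoment_succ_succ b n
  have h3 : (2 * n + 2 : ℝ) ≠ 0 := by positivity
  apply mul_left_cancel₀ h3
  have h4 : (2 * n + 2 : ℝ) * (1 / ((n + 1 : ℕ) : ℝ) ^ 2) = 2 / (n + 1) := by
    push_cast; field_simp
  rw [← mul_assoc (2 * n + 2 : ℝ) (1 / _), h4]
  linear_combination (-cosMoment (b + 1) n) * h1 + momentScale (n + 1) * h2

lemma cosMoment_nonneg (b n : ℕ) : 0 ≤ cosMoment b n := by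
  refine intervalIntegral.integral_nonneg (by positivity) fun x hx => ?_
  rw [pow_mul]
  exact mul_nonneg (dividedPow_nonneg _ hx.1) (by positivity)

lemma scaled_cosMoment_succ_le (b n : ℕ) :
    momentScale n * cosMoment (b + 1) n ≤ π ^ (2 * b + 2) / (2 * n + 2) := by
  have h : cosMoment (b + 1) n ≤ π ^ (2 * b + 2) * (cosMoment 0 n - cosMoment 0 (n + 1)) := by
    unfold cosMoment
    rw [← intervalIntegral.integral_sub (intervalIntegrable_dividedPow_mul_cos _ _)
      (intervalIntegrable_dividedPow_mul_cos _ _), ← intervalIntegral.integral_const_mul]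
    refine intervalIntegral.integral_mono_on (by positivity)
      (intervalIntegrable_dividedPow_mul_cos _ _)
      (((intervalIntegrable_dividedPow_mul_cos _ _).sub
        (intervalIntegrable_dividedPow_mul_cos _ _)).const_mul _) fun x hx => ?_
    have hs : 2 * x ≤ π * sin x := by
      have := mul_le_sin hx.1 hx.2
      rw [div_mul_eq_mul_div, div_le_iff₀ pi_pos] at this
      linarith
    have h0 : (0 : ℝ) ≤ 2 * x := by linarith [hx.1]
    have hle : dividedPow (2 * (b + 1)) x ≤ π ^ (2 * b + 2) * sin x ^ 2 := by
      calc dividedPow (2 * (b + 1)) x ≤ (2 * x) ^ (2 * (b + 1)) :=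
            div_le_self (by positivity) (by exact_mod_cast Nat.factorial_pos _)
        _ = (2 * x) ^ (2 * b) * (2 * x) ^ 2 := by ring
        _ ≤ π ^ (2 * b) * (π * sin x) ^ 2 := by
            gcongr
            linarith [hx.2]
        _ = _ := by ring
    have hc : 0 ≤ cos x ^ (2 * n) := by rw [pow_mul]; positivity
    calc dividedPow (2 * (b + 1)) x * cos x ^ (2 * n)
        ≤ π ^ (2 * b + 2) * sin x ^ 2 * cos x ^ (2 * n) := by gcongr
      _ = _ := by
        rw [sin_sq, Nat.mul_zero, dividedPow_zero]; ring
  have h1 := momentScale_mul_cosMoment_zero n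
  have h2 := cosMoment_zero_succ n
  have h3 := momentScale_pos n
  have h4 : (2 * n + 2 : ℝ) ≠ 0 := by positivity
  calc momentScale n * cosMoment (b + 1) n
      ≤ momentScale n * (π ^ (2 * b + 2) * (cosMoment 0 n - cosMoment 0 (n + 1))) := by gcongr
    _ = π ^ (2 * b + 2) / (2 * n + 2) := by
      rw [eq_div_iff h4]
      linear_combination π ^ (2 * b + 2) * (h1 - momentScale n * h2)

lemma tendsto_scaled_cosMoment_succ (b : ℕ) :
    Tendsto (fun n => momentScale n * cosMoment (b + 1) n) atTop (𝓝 0) := by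
  refine squeeze_zero (fun n => mul_nonneg (momentScale_pos n).le (cosMoment_nonneg _ n))
    (scaled_cosMoment_succ_le b) ?_
  refine Tendsto.div_atTop tendsto_const_nhds ?_
  exact tendsto_atTop_add_const_right _ _
    (tendsto_natCast_atTop_atTop.const_mul_atTop (by norm_num))

lemma hasSum_scaled_cosMoment (b N : ℕ) :
    HasSum (fun d : ℕ => 1 / ((N + d + 1 : ℕ) : ℝ) ^ 2 *
      (momentScale (N + d + 1) * cosMoment b (N + d + 1)))
      (momentScale N * cosMoment (b + 1) N) := by
  rw [hasSum_iff_tendsto_nat_of_nonneg (fun d => mul_nonneg (by positivity)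
    (mul_nonneg (momentScale_pos _).le (cosMoment_nonneg _ _)))]
  have h : ∀ n, ∑ d ∈ Finset.range n, 1 / ((N + d + 1 : ℕ) : ℝ) ^ 2 *
      (momentScale (N + d + 1) * cosMoment b (N + d + 1)) =
      momentScale N * cosMoment (b + 1) N -
        momentScale (N + n) * cosMoment (b + 1) (N + n) := by
    intro n
    rw [Finset.sum_congr rfl fun d _ => (scaled_cosMoment_sub b (N + d)).symm]
    exact Finset.sum_range_sub' (fun d => momentScale (N + d) * cosMoment (b + 1) (N + d)) n
  simp only [h]
  have := ((tendsto_add_atTop_iff_nat N).2 (tendsto_scaled_cosMoment_succ b)).const_sub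
    (momentScale N * cosMoment (b + 1) N)
  simpa [add_comm] using this

lemma truncTwos_le (a n : ℕ) : truncTwos a n ≤ (∑' m : ℕ, 1 / (m : ℝ) ^ 2) ^ a := by
  have hs : Summable fun m : ℕ => 1 / (m : ℝ) ^ 2 := summable_one_div_nat_pow.2 one_lt_two
  have h0 : 0 ≤ ∑' m : ℕ, 1 / (m : ℝ) ^ 2 := tsum_nonneg fun m => by positivity
  induction a generalizing n with
  | zero => simp [truncTwos]
  | succ a ih =>
    calc truncTwos (a + 1) n
        ≤ ∑ m ∈ Finset.range n, (∑' m : ℕ, 1 / (m : ℝ) ^ 2) ^ a * (1 / (m : ℝ) ^ 2) :=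
          Finset.sum_le_sum fun m _ => mul_le_mul_of_nonneg_right (ih m) (by positivity)
      _ = (∑' m : ℕ, 1 / (m : ℝ) ^ 2) ^ a * ∑ m ∈ Finset.range n, 1 / (m : ℝ) ^ 2 := by
          rw [Finset.mul_sum]
      _ ≤ (∑' m : ℕ, 1 / (m : ℝ) ^ 2) ^ a * ∑' m : ℕ, 1 / (m : ℝ) ^ 2 := by
          gcongr
          exact hs.sum_le_tsum _ fun m _ => by positivity
      _ = _ := (pow_succ _ _).symm

/-- The normalised even power `(2 sin u)^{2n} / C(2n, n)` of the sine. -/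
noncomputable def sinPow (n : ℕ) (u : ℝ) : ℝ := (2 * sin u) ^ (2 * n) / n.centralBinom

lemma sinPow_zero (u : ℝ) : sinPow 0 u = 1 := by simp [sinPow]

lemma sinPow_nonneg (n : ℕ) (u : ℝ) : 0 ≤ sinPow n u := by
  unfold sinPow; rw [pow_mul]; positivity

lemma continuous_sinPow (n : ℕ) : Continuous (sinPow n) := by
  unfold sinPow; fun_prop

lemma hasDerivAt_sinPow_succ (n : ℕ) (u : ℝ) :
    HasDerivAt (sinPow (n + 1))
      (4 * (n + 1) * ((2 * sin u) ^ (2 * n + 1) * cos u) / (n + 1).centralBinom) u := by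
  have h := (((hasDerivAt_sin u).const_mul 2).pow (2 * (n + 1))).div_const
    ((n + 1).centralBinom : ℝ)
  refine h.congr_deriv ?_
  rw [show 2 * (n + 1) - 1 = 2 * n + 1 by omega]
  push_cast
  ring

lemma hasDerivAt_deriv_sinPow_succ (n : ℕ) (u : ℝ) :
    HasDerivAt
      (fun u => 4 * (n + 1) * ((2 * sin u) ^ (2 * n + 1) * cos u) / (n + 1).centralBinom)
      (4 * (n + 1) ^ 2 * (sinPow n u - sinPow (n + 1) u)) u := by
  have h := (((((hasDerivAt_sin u).const_mul 2).pow (2 * n + 1)).mul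
    (hasDerivAt_cos u)).const_mul (4 * (n + 1 : ℝ))).div_const ((n + 1).centralBinom : ℝ)
  refine h.congr_deriv ?_
  have hb : ((n : ℝ) + 1) * (n + 1).centralBinom = 2 * (2 * n + 1) * n.centralBinom := by
    exact_mod_cast n.succ_mul_centralBinom_succ
  have h1 : (n.centralBinom : ℝ) ≠ 0 := by exact_mod_cast n.centralBinom_ne_zero
  have h2 : ((n + 1).centralBinom : ℝ) ≠ 0 := by exact_mod_cast (n + 1).centralBinom_ne_zero
  have hc : cos u ^ 2 = 1 - sin u ^ 2 := cos_sq' u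
  simp only [sinPow, Nat.add_sub_cancel, Nat.mul_succ, Pi.pow_apply]
  push_cast
  field_simp
  simp only [mul_pow, pow_add, pow_one]
  linear_combination (2 * (2 * n + 1) * n.centralBinom * 2 ^ (2 * n) * sin u ^ (2 * n)) * hc -
    2 ^ (2 * n) * sin u ^ (2 * n) * hb

lemma sub_mul_integral_of_hasDerivAt {g g' g'' : ℝ → ℝ} (u : ℝ) (hg : ∀ v, HasDerivAt g (g' v) v)
    (hg' : ∀ v, HasDerivAt g' (g'' v) v) (hc : Continuous g'') (h0 : g 0 = 0) (h0' : g' 0 = 0) :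
    ∫ v in (0 : ℝ)..u, (u - v) * g'' v = g u := by
  have hd : ∀ v, HasDerivAt (fun v => (u - v) * g' v + g v) ((u - v) * g'' v) v := fun v =>
    ((((hasDerivAt_id v).const_sub u).mul (hg' v)).add (hg v)).congr_deriv (by simp)
  rw [intervalIntegral.integral_eq_sub_of_hasDerivAt (fun v _ => hd v)
    (Continuous.intervalIntegrable (by fun_prop) _ _)]
  simp [h0, h0']

lemma sinPow_succ_eq_integral (n : ℕ) (u : ℝ) :
    1 / ((n + 1 : ℕ) : ℝ) ^ 2 * sinPow (n + 1) u =
      ∫ v in (0 : ℝ)..u, (u - v) * (4 * (sinPow n v - sinPow (n + 1) v)) := by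
  have h := sub_mul_integral_of_hasDerivAt u (hasDerivAt_sinPow_succ n)
    (hasDerivAt_deriv_sinPow_succ n)
    (((continuous_sinPow n).sub (continuous_sinPow (n + 1))).const_mul _)
    (by simp [sinPow]) (by simp)
  rw [← h, ← intervalIntegral.integral_const_mul]
  congr 1
  funext v
  push_cast
  field_simp

lemma dividedPow_eq_integral (n : ℕ) (u : ℝ) :
    dividedPow (n + 2) u = ∫ v in (0 : ℝ)..u, (u - v) * (4 * dividedPow n v) := by
  refine (sub_mul_integral_of_hasDerivAt u (hasDerivAt_dividedPow_succ (n + 1))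
    (fun v => ?_) ((continuous_dividedPow n).const_mul 4) (dividedPow_succ_apply_zero _)
    (by rw [dividedPow_succ_apply_zero, mul_zero])).symm
  exact ((hasDerivAt_dividedPow_succ n v).const_mul 2).congr_deriv (by ring)

/-- Summation by parts. -/
lemma sum_range_mul_sub (E h : ℕ → ℝ) (N : ℕ) :
    ∑ n ∈ Finset.range N, E (n + 1) * (h n - h (n + 1)) =
      E 0 * h 0 + ∑ n ∈ Finset.range N, (E (n + 1) - E n) * h n - E N * h N := by
  induction N with
  | zero => simp
  | succ N ih => rw [Finset.sum_range_succ, Finset.sum_range_succ, ih]; ring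

lemma sinPow_le (n : ℕ) {u v : ℝ} (hv : 0 ≤ v) (hvu : v ≤ u) (hu : u < π / 2) :
    sinPow (n + 1) v ≤ 2 * (((n + 1 : ℕ) : ℝ) * (sin u ^ 2) ^ (n + 1)) := by
  have hb : (4 : ℝ) ^ (n + 1) ≤ 2 * ((n + 1 : ℕ) : ℝ) * (n + 1).centralBinom := by
    exact_mod_cast Nat.four_pow_le_two_mul_self_mul_centralBinom (n + 1) n.succ_pos
  have hc : 0 < ((n + 1).centralBinom : ℝ) := by exact_mod_cast (n + 1).centralBinom_pos
  have h0 : 0 ≤ sin v := sin_nonneg_of_nonneg_of_le_pi hv (by linarith [pi_pos])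
  have hs : sin v ≤ sin u := sin_le_sin_of_le_of_le_pi_div_two (by linarith) hu.le hvu
  unfold sinPow
  rw [div_le_iff₀ hc, mul_pow, pow_mul, pow_mul (sin v)]
  calc ((2 : ℝ) ^ 2) ^ (n + 1) * (sin v ^ 2) ^ (n + 1)
      ≤ (2 * ((n + 1 : ℕ) : ℝ) * (n + 1).centralBinom) * (sin u ^ 2) ^ (n + 1) := by
        norm_num at hb ⊢
        gcongr
    _ = _ := by ring

lemma tendsto_mul_sin_sq_pow {u : ℝ} (h0 : 0 ≤ u) (hu : u < π / 2) :
    Tendsto (fun n : ℕ => 2 * (((n + 1 : ℕ) : ℝ) * (sin u ^ 2) ^ (n + 1))) atTop (𝓝 0) := by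
  have hlt : sin u ^ 2 < 1 := by
    rw [sin_sq]
    have : 0 < cos u := cos_pos_of_mem_Ioo ⟨by linarith, hu⟩
    nlinarith
  have h := (tendsto_self_mul_const_pow_of_lt_one (sq_nonneg (sin u)) hlt).const_mul 2
  rw [mul_zero] at h
  exact h.comp (tendsto_add_atTop_nat 1)

/-- If the increments of a bounded weight `E`, paired with `sinPow`, sum to `dividedPow k`, then
`E` itself, paired with `sinPow n / n ^ 2`, sums to `dividedPow (k + 2)`. -/
lemma tendsto_sum_mul_sinPow {E : ℕ → ℝ} {M : ℝ} (hE : ∀ n, 0 ≤ E n) (hM : ∀ n, E n ≤ M) {k : ℕ}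
    (hmono : ∀ n, E n ≤ E (n + 1))
    {u : ℝ} (h0 : 0 ≤ u) (hu : u < π / 2)
    (hlim : ∀ v, 0 ≤ v → v ≤ u → Tendsto (fun N => E 0 * sinPow 0 v +
      ∑ n ∈ Finset.range N, (E (n + 1) - E n) * sinPow n v) atTop (𝓝 (dividedPow k v))) :
    HasSum (fun n : ℕ => E n * (1 / (n : ℝ) ^ 2 * sinPow n u)) (dividedPow (k + 2) u) := by
  rw [hasSum_iff_tendsto_nat_of_nonneg fun n =>
    mul_nonneg (hE n) (mul_nonneg (by positivity) (sinPow_nonneg n u))]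
  rw [← tendsto_add_atTop_iff_nat 1, ← tendsto_add_atTop_iff_nat 1]
  set S : ℕ → ℝ → ℝ := fun N v => E 0 * sinPow 0 v +
      ∑ n ∈ Finset.range N, (E (n + 1) - E n) * sinPow n v with hS
  have hsum : ∀ N, ∑ n ∈ Finset.range (N + 1), E n * (1 / (n : ℝ) ^ 2 * sinPow n u) =
      ∫ v in (0 : ℝ)..u, (u - v) * (4 * (S N v - E N * sinPow N v)) := by
    intro N
    rw [Finset.sum_range_succ']
    simp only [sinPow_succ_eq_integral, ← intervalIntegral.integral_const_mul]
    rw [← intervalIntegral.integral_finsetSum]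
    · simp only [Nat.cast_zero, zero_pow two_ne_zero, div_zero, zero_mul, mul_zero, add_zero]
      congr 1
      funext v
      rw [hS, ← sum_range_mul_sub E (fun n => sinPow n v) N, Finset.mul_sum, Finset.mul_sum]
      exact Finset.sum_congr rfl fun n _ => by ring
    · intro n _
      have := continuous_sinPow n
      have := continuous_sinPow (n + 1)
      exact Continuous.intervalIntegrable (by fun_prop) _ _
  simp only [hsum]
  rw [dividedPow_eq_integral]
  obtain ⟨B, hB⟩ := (tendsto_mul_sin_sq_pow h0 hu).bddAbove_range
  have hM0 : 0 ≤ M := (hE 0).trans (hM 0)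
  refine intervalIntegral.tendsto_integral_filter_of_dominated_convergence
    (fun v => u * (4 * (dividedPow k v + M * B))) ?_ ?_ ?_ ?_
  · refine Eventually.of_forall fun N => Continuous.aestronglyMeasurable ?_
    have := continuous_sinPow
    fun_prop
  · refine Eventually.of_forall fun N => ae_of_all _ fun v hv => ?_
    rw [Set.uIoc_of_le h0] at hv
    have hSnn : ∀ N, 0 ≤ S N v := fun N => add_nonneg (mul_nonneg (hE 0) (sinPow_nonneg _ _))
      (Finset.sum_nonneg fun n _ => mul_nonneg (sub_nonneg.2 (hmono n)) (sinPow_nonneg _ _))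
    have hSm : Monotone fun N => S N v := by
      refine monotone_nat_of_le_succ fun N => ?_
      simp only [hS, Finset.sum_range_succ]
      have := mul_nonneg (sub_nonneg.2 (hmono N)) (sinPow_nonneg N v)
      linarith
    have hSle : S (N + 1) v ≤ dividedPow k v :=
      hSm.ge_of_tendsto (hlim v hv.1.le hv.2) (N + 1)
    have hEle : E (N + 1) * sinPow (N + 1) v ≤ M * B := by
      have h1 := (sinPow_le N hv.1.le hv.2 hu).trans (hB (Set.mem_range_self N))
      exact mul_le_mul (hM _) h1 (sinPow_nonneg _ _) hM0
    have hEnn : 0 ≤ E (N + 1) * sinPow (N + 1) v := mul_nonneg (hE _) (sinPow_nonneg _ _)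
    rw [norm_mul, norm_mul, norm_of_nonneg (sub_nonneg.2 hv.2), norm_of_nonneg zero_le_four]
    gcongr
    · linarith [hv.1]
    · rw [norm_eq_abs, abs_le]
      constructor <;> linarith [hSnn (N + 1)]
  · have := continuous_dividedPow k
    exact Continuous.intervalIntegrable (by fun_prop) _ _
  · refine ae_of_all _ fun v hv => ?_
    rw [Set.uIoc_of_le h0] at hv
    have h1 : Tendsto (fun N => E (N + 1) * sinPow (N + 1) v) atTop (𝓝 0) := by
      refine squeeze_zero (fun N => mul_nonneg (hE _) (sinPow_nonneg _ _)) (fun N =>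
        mul_le_mul (hM _) (sinPow_le N hv.1.le hv.2 hu) (sinPow_nonneg _ _) hM0) ?_
      simpa using (tendsto_mul_sin_sq_pow h0 hu).const_mul M
    have h2 := ((hlim v hv.1.le hv.2).comp (tendsto_add_atTop_nat 1)).sub h1
    rw [sub_zero] at h2
    exact (h2.const_mul 4).const_mul (u - v)

lemma truncTwos_succ_sub (a n : ℕ) :
    truncTwos (a + 1) (n + 1) - truncTwos (a + 1) n = truncTwos a n * (1 / (n : ℝ) ^ 2) := by
  simp [truncTwos, Finset.sum_range_succ]

/-- The power series expansion of even powers of the arcsine. -/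
lemma hasSum_truncTwos_mul_sinPow (a : ℕ) {u : ℝ} (h0 : 0 ≤ u) (hu : u < π / 2) :
    HasSum (fun n : ℕ => truncTwos a n * (1 / (n : ℝ) ^ 2 * sinPow n u))
      (dividedPow (2 * a + 2) u) := by
  induction a generalizing u with
  | zero =>
    refine tendsto_sum_mul_sinPow (truncTwos_nonneg 0) (truncTwos_le 0) (fun n => ?_) h0 hu
      fun v _ _ => ?_
    · simp [truncTwos]
    · simp [truncTwos, sinPow_zero, dividedPow_zero]
  | succ a ih =>
    refine tendsto_sum_mul_sinPow (truncTwos_nonneg _) (truncTwos_le _) (fun n => ?_) h0 hu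
      fun v hv hvu => ?_
    · rw [← sub_nonneg, truncTwos_succ_sub]
      exact mul_nonneg (truncTwos_nonneg _ _) (by positivity)
    · have h := (ih hv (hvu.trans_lt hu)).tendsto_sum_nat
      simp only [truncTwos_succ_sub]
      simpa [truncTwos, mul_assoc, Nat.mul_succ] using h

lemma hasSum_riemannZetaReal {k : ℕ} (hk : 1 < k) :
    HasSum (fun n : ℕ => 1 / ((n + 1 : ℕ) : ℝ) ^ k) (riemannZetaReal k) := by
  have hs : Summable fun n : ℕ => 1 / ((n + 1 : ℕ) : ℝ) ^ k :=
    (summable_nat_add_iff (f := fun n : ℕ => 1 / (n : ℝ) ^ k) 1).2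
      (summable_one_div_nat_pow.2 hk)
  have h := hs.hasSum
  rwa [← tsum_pnat_eq_tsum_succ (f := fun n : ℕ => 1 / (n : ℝ) ^ k)] at h

lemma hasSum_alternating_zeta {k : ℕ} (hk : 0 < k) :
    HasSum (fun n : ℕ => (-1 : ℝ) ^ n / ((n + 1 : ℕ) : ℝ) ^ (k + 1))
      ((1 - 1 / 2 ^ k) * riemannZetaReal (k + 1)) := by
  have hz := hasSum_riemannZetaReal (show 1 < k + 1 by omega)
  have hodd : HasSum (fun m : ℕ => 2 * (1 / ((2 * m + 1 + 1 : ℕ) : ℝ) ^ (k + 1)))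
      (1 / 2 ^ k * riemannZetaReal (k + 1)) := by
    refine (hz.mul_left (1 / 2 ^ k)).congr_fun fun m => ?_
    have : ((2 * m + 1 + 1 : ℕ) : ℝ) = 2 * ((m + 1 : ℕ) : ℝ) := by push_cast; ring
    rw [this, mul_pow, pow_succ (2 : ℝ) k]
    field_simp
  obtain ⟨f, hf⟩ : ∃ f : ℕ → ℝ, f = fun n => if Odd n then
      2 * (1 / ((n + 1 : ℕ) : ℝ) ^ (k + 1)) else 0 := ⟨_, rfl⟩
  have heven : HasSum (fun m : ℕ => f (2 * m)) 0 := by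
    have : ∀ m, f (2 * m) = 0 := fun m => by rw [hf]; exact if_neg (by simp)
    simp only [this]
    exact hasSum_zero
  have hodd' : HasSum (fun m : ℕ => f (2 * m + 1)) (1 / 2 ^ k * riemannZetaReal (k + 1)) :=
    hodd.congr_fun fun m => by rw [hf]; exact if_pos (odd_two_mul_add_one m)
  have h := hz.sub (heven.even_add_odd hodd')
  rw [zero_add] at h
  rw [sub_mul, one_mul]
  refine h.congr_fun fun n => ?_
  rw [hf]
  dsimp only
  rcases Nat.even_or_odd n with hn | hn
  · simp [hn.neg_one_pow, Nat.not_odd_iff_even.2 hn]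
  · rw [hn.neg_one_pow, if_pos hn]; ring

lemma two_mul_sum_sin {y : ℝ} (hy : sin (y / 2) ≠ 0) (N : ℕ) :
    2 * ∑ k ∈ Finset.range N, sin ((k + 1 : ℕ) * y) =
      cos (y / 2) / sin (y / 2) * (1 - cos (N * y)) + sin (N * y) := by
  induction N with
  | zero => simp
  | succ N ih =>
    rw [Finset.sum_range_succ, mul_add, ih]
    have h1 : ((N + 1 : ℕ) : ℝ) * y = (N * y + y / 2) + y / 2 := by push_cast; ring
    have h2 : (N : ℝ) * y = (N * y + y / 2) - y / 2 := by ring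
    rw [h1]
    generalize hz : (N : ℝ) * y + y / 2 = z at *
    rw [h2, cos_add, cos_sub, sin_add, sin_sub]
    field_simp
    ring

lemma tendsto_intervalIntegral_exp (f : ℝ → ℝ) {a b : ℝ} (hab : a ≤ b) :
    Tendsto (fun N : ℕ => ∫ y in a..b, Complex.exp (-(N * y : ℝ) * Complex.I) * (f y : ℂ))
      atTop (𝓝 0) := by
  have h := Real.tendsto_integral_exp_smul_cocompact
    ((Set.Ioc a b).indicator fun y => (f y : ℂ))
  have hw : Tendsto (fun N : ℕ => (N : ℝ) / (2 * π)) atTop (cocompact ℝ) :=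
    (tendsto_natCast_atTop_atTop.atTop_div_const (by positivity)).mono_right atTop_le_cocompact
  refine (h.comp hw).congr fun N => ?_
  rw [intervalIntegral.integral_of_le hab, ← integral_indicator measurableSet_Ioc]
  refine integral_congr_ae (ae_of_all _ fun y => ?_)
  by_cases hy : y ∈ Set.Ioc a b
  · simp only [Set.indicator_of_mem hy, Real.fourierChar_apply, Circle.smul_def, smul_eq_mul]
    congr 2
    have : (π : ℂ) ≠ 0 := by exact_mod_cast pi_ne_zero
    push_cast
    field_simp
  · simp [Set.indicator_of_notMem hy]

lemma tendsto_intervalIntegral_mul_cos {f : ℝ → ℝ} {a b : ℝ} (hab : a ≤ b)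
    (hf : IntervalIntegrable f volume a b) :
    Tendsto (fun N : ℕ => ∫ y in a..b, f y * cos (N * y)) atTop (𝓝 0) := by
  have h := (Complex.continuous_re.tendsto _).comp (tendsto_intervalIntegral_exp f hab)
  rw [Complex.zero_re] at h
  refine h.congr fun N => ?_
  have hi : IntervalIntegrable (fun y => Complex.exp (-(N * y : ℝ) * Complex.I) * (f y : ℂ))
      volume a b := 
    IntervalIntegrable.continuousOn_mul (f := fun y => (f y : ℂ)) ⟨hf.1.ofReal, hf.2.ofReal⟩
      (by fun_prop)
  simp only [Function.comp_apply]
  have := Complex.reCLM.intervalIntegral_comp_comm hi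
  simp only [Complex.reCLM_apply] at this
  rw [← this]
  congr 1
  funext y
  rw [← Complex.ofReal_neg, Complex.re_mul_ofReal, Complex.exp_ofReal_mul_I_re, cos_neg, mul_comm]

lemma tendsto_intervalIntegral_mul_sin {f : ℝ → ℝ} {a b : ℝ} (hab : a ≤ b)
    (hf : IntervalIntegrable f volume a b) :
    Tendsto (fun N : ℕ => ∫ y in a..b, f y * sin (N * y)) atTop (𝓝 0) := by
  have h := ((Complex.continuous_im.tendsto _).comp (tendsto_intervalIntegral_exp f hab)).neg
  rw [Complex.zero_im, neg_zero] at h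
  refine h.congr fun N => ?_
  have hi : IntervalIntegrable (fun y => Complex.exp (-(N * y : ℝ) * Complex.I) * (f y : ℂ))
      volume a b := 
    IntervalIntegrable.continuousOn_mul (f := fun y => (f y : ℂ)) ⟨hf.1.ofReal, hf.2.ofReal⟩
      (by fun_prop)
  simp only [Function.comp_apply]
  have := Complex.imCLM.intervalIntegral_comp_comm hi
  simp only [Complex.imCLM_apply] at this
  rw [← this, ← intervalIntegral.integral_neg]
  congr 1
  funext y
  rw [← Complex.ofReal_neg, Complex.im_mul_ofReal, Complex.exp_ofReal_mul_I_im, sin_neg]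
  ring

/-- Fourier sine expansion of the cotangent, integrated against a function. -/
lemma tendsto_sum_integral_mul_sin {f : ℝ → ℝ}
    (hf : IntervalIntegrable f volume 0 π)
    (hc : IntervalIntegrable (fun y => f y * (cos (y / 2) / sin (y / 2))) volume 0 π) :
    Tendsto (fun N : ℕ => 2 * ∑ k ∈ Finset.range N, ∫ y in (0 : ℝ)..π, f y * sin ((k + 1 : ℕ) * y))
      atTop (𝓝 (∫ y in (0 : ℝ)..π, f y * (cos (y / 2) / sin (y / 2)))) := by
  have hlim := ((tendsto_intervalIntegral_mul_cos pi_pos.le hc).const_sub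
    (∫ y in (0 : ℝ)..π, f y * (cos (y / 2) / sin (y / 2)))).add
    (tendsto_intervalIntegral_mul_sin pi_pos.le hf)
  rw [sub_zero, add_zero] at hlim
  refine hlim.congr fun N => ?_
  have hcN := hc.mul_continuousOn (g := fun y => cos (N * y)) (by fun_prop)
  have hfN : ∀ N : ℕ, IntervalIntegrable (fun y => f y * sin (N * y)) volume 0 π :=
    fun N => hf.mul_continuousOn (by fun_prop)
  rw [← intervalIntegral.integral_finsetSum (fun k _ => hfN (k + 1)),
    ← intervalIntegral.integral_const_mul, ← intervalIntegral.integral_sub hc hcN,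
    ← intervalIntegral.integral_add (hc.sub hcN) (hfN N)]
  refine intervalIntegral.integral_congr_ae (ae_of_all _ fun y hy => ?_)
  rw [Set.uIoc_of_le pi_pos.le] at hy
  have hs : sin (y / 2) ≠ 0 :=
    (sin_pos_of_pos_of_lt_pi (by linarith [hy.1]) (by linarith [hy.2, pi_pos])).ne'
  rw [← Finset.mul_sum, mul_left_comm, two_mul_sum_sin hs]
  ring

open Polynomial in
lemma integral_polynomial_mul_sin_step (P : ℝ[X]) {n : ℕ} (hn : n ≠ 0) :
    ∫ y in (0 : ℝ)..π, P.eval y * sin (n * y) =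
      (P.eval 0 - (-1) ^ n * P.eval π) / n -
        1 / (n : ℝ) ^ 2 *
          ∫ y in (0 : ℝ)..π, (derivative (derivative P)).eval y * sin (n * y) := by
  have hn' : (n : ℝ) ≠ 0 := by exact_mod_cast hn
  have hd : ∀ y, HasDerivAt (fun y => -(P.eval y * cos (n * y) / n) +
      (derivative P).eval y * sin (n * y) / (n : ℝ) ^ 2)
      (P.eval y * sin (n * y) +
        1 / (n : ℝ) ^ 2 * ((derivative (derivative P)).eval y * sin (n * y))) y := by
    intro y
    have hl : HasDerivAt (fun y : ℝ => (n : ℝ) * y) n y := by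
      simpa using (hasDerivAt_id y).const_mul (n : ℝ)
    refine ((((P.hasDerivAt y).mul hl.cos).div_const _).neg.add
      ((((derivative P).hasDerivAt y).mul hl.sin).div_const _)).congr_deriv ?_
    field_simp
    ring
  have hi : ∀ Q : ℝ[X], IntervalIntegrable (fun y => Q.eval y * sin (n * y)) volume 0 π :=
    fun Q => Continuous.intervalIntegrable (by fun_prop) _ _
  have h := intervalIntegral.integral_eq_sub_of_hasDerivAt (a := 0) (b := π)
    (fun y _ => hd y) ((hi _).add ((hi _).const_mul _))
  rw [intervalIntegral.integral_add (hi _) ((hi _).const_mul _),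
    intervalIntegral.integral_const_mul] at h
  rw [eq_sub_iff_add_eq, h]
  simp only [cos_nat_mul_pi, sin_nat_mul_pi, mul_zero, cos_zero, sin_zero]
  field_simp
  ring

open Polynomial in
lemma integral_polynomial_mul_sin (M : ℕ) (P : ℝ[X]) (hP : P.natDegree ≤ 2 * M + 1) {n : ℕ}
    (hn : n ≠ 0) :
    ∫ y in (0 : ℝ)..π, P.eval y * sin (n * y) =
      ∑ j ∈ Finset.range (M + 1), (-1) ^ j * ((derivative^[2 * j] P).eval 0 -
        (-1) ^ n * (derivative^[2 * j] P).eval π) / (n : ℝ) ^ (2 * j + 1) := by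
  induction M generalizing P with
  | zero =>
    have h : derivative (derivative P) = 0 := by
      have := Polynomial.iterate_derivative_eq_zero (p := P) (x := 2) (by omega)
      simpa using this
    rw [integral_polynomial_mul_sin_step P hn, h]
    simp
  | succ M ih =>
    have hd : (derivative (derivative P)).natDegree ≤ 2 * M + 1 := by
      have h1 := natDegree_derivative_le P
      have h2 := natDegree_derivative_le (derivative P)
      omega
    rw [integral_polynomial_mul_sin_step P hn, ih _ hd, Finset.sum_range_succ' _ (M + 1),
      Finset.mul_sum, sub_eq_add_neg, add_comm, ← Finset.sum_neg_distrib]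
    congr 1
    · refine Finset.sum_congr rfl fun j _ => ?_
      have e : derivative^[2 * (j + 1)] P = derivative^[2 * j] (derivative (derivative P)) := by
        rw [Nat.mul_succ, Function.iterate_add_apply]; rfl
      have hn' : (n : ℝ) ≠ 0 := by exact_mod_cast hn
      rw [e]
      field_simp
      ring
    · simp

open Polynomial in
/-- Integrals of polynomials vanishing at `0` and `π` against the cotangent of the half angle, in
terms of odd zeta values. -/
lemma integral_polynomial_mul_cot (M : ℕ) (P : ℝ[X]) (hP : P.natDegree ≤ 2 * M + 1)
    (h0 : P.eval 0 = 0) (hpi : P.eval π = 0)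
    (hc : IntervalIntegrable (fun y => P.eval y * (cos (y / 2) / sin (y / 2))) volume 0 π) :
    ∫ y in (0 : ℝ)..π, P.eval y * (cos (y / 2) / sin (y / 2)) =
      2 * ∑ j ∈ Finset.Icc 1 M, (-1) ^ j * ((derivative^[2 * j] P).eval 0 +
        (1 - 1 / 2 ^ (2 * j)) * (derivative^[2 * j] P).eval π) * riemannZetaReal (2 * j + 1) := by
  refine tendsto_nhds_unique (tendsto_sum_integral_mul_sin
    (Continuous.intervalIntegrable (by fun_prop) _ _) hc) ?_
  refine Tendsto.const_mul 2 ?_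
  have hterm : ∀ k : ℕ, ∫ y in (0 : ℝ)..π, P.eval y * sin ((k + 1 : ℕ) * y) =
      ∑ j ∈ Finset.Icc 1 M, ((-1) ^ j * (derivative^[2 * j] P).eval 0 *
        (1 / ((k + 1 : ℕ) : ℝ) ^ (2 * j + 1)) + (-1) ^ j * (derivative^[2 * j] P).eval π *
        ((-1) ^ k / ((k + 1 : ℕ) : ℝ) ^ (2 * j + 1))) := by
    intro k
    rw [integral_polynomial_mul_sin M P hP k.succ_ne_zero, Finset.range_eq_Ico,
      Finset.sum_eq_sum_Ico_succ_bot M.succ_pos]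
    simp only [mul_zero, Function.iterate_zero, id, h0, hpi, sub_zero, zero_div, zero_add]
    refine Finset.sum_congr rfl fun j _ => ?_
    rw [pow_succ (-1 : ℝ) k]
    ring
  simp only [hterm]
  refine HasSum.tendsto_sum_nat (hasSum_sum fun j hj => ?_)
  have hj' := (Finset.mem_Icc.1 hj).1
  have h := ((hasSum_riemannZetaReal (show 1 < 2 * j + 1 by omega)).mul_left
    ((-1) ^ j * (derivative^[2 * j] P).eval 0)).add
    ((hasSum_alternating_zeta (show 0 < 2 * j by omega)).mul_left
    ((-1) ^ j * (derivative^[2 * j] P).eval π))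
  refine (congrArg (HasSum _) ?_).mpr h
  ring

lemma tsum_ite_lt_eq (N : ℕ) (f : ℕ → ENNReal) :
    (∑' x : ℕ, if N < x then f x else 0) = ∑' d : ℕ, f (N + d + 1) := by
  rw [← ENNReal.summable.sum_add_tsum_nat_add' (k := N + 1) (f := fun x => if N < x then f x else 0),
    Finset.sum_eq_zero (fun x hx => if_neg (by simpa [Nat.lt_succ_iff] using hx)), zero_add]
  refine tsum_congr fun d => ?_
  rw [if_pos (by omega), show d + (N + 1) = N + d + 1 by ring]

/-- Tails of the multiple zeta values `ζ(2, …, 2)` are cosine moments. -/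
lemma mzvTail_twos (b N : ℕ) :
    mzvTail (fun _ : Fin b => 2) N = ENNReal.ofReal (momentScale N * cosMoment b N) := by
  induction b generalizing N with
  | zero => rw [mzvTail_fin_zero, momentScale_mul_cosMoment_zero, ENNReal.ofReal_one]
  | succ b ih =>
    have h := hasSum_scaled_cosMoment b N
    rw [mzvTail_succ]
    refine (tsum_ite_lt_eq N fun x => ENNReal.ofReal (1 / (x : ℝ) ^ 2) *
      mzvTail (fun _ : Fin b => 2) x).trans ?_
    rw [← h.tsum_eq,
      ENNReal.ofReal_tsum_of_nonneg (fun d => mul_nonneg (by positivity)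
        (mul_nonneg (momentScale_pos _).le (cosMoment_nonneg _ _))) h.summable]
    exact tsum_congr fun d => by rw [ih, ← ENNReal.ofReal_mul (by positivity)]

lemma mzv_twos (j : ℕ) :
    mzv (fun _ : Fin j => 2) = π ^ (2 * j) / (2 * j + 1).factorial := by
  rw [← toReal_mzvTail_zero, mzvTail_twos, ENNReal.toReal_ofReal
    (mul_nonneg (momentScale_pos _).le (cosMoment_nonneg _ _))]
  have hi : cosMoment j 0 = 1 / 2 * dividedPow (2 * j + 1) (π / 2) := by
    have h := intervalIntegral.integral_eq_sub_of_hasDerivAt (a := 0) (b := π / 2)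
      (fun x _ => hasDerivAt_dividedPow_succ (2 * j) x)
      (((continuous_dividedPow _).const_mul 2).intervalIntegrable _ _)
    rw [intervalIntegral.integral_const_mul, dividedPow_succ_apply_zero] at h
    simp only [cosMoment, mul_zero, pow_zero, mul_one]
    linarith
  rw [hi]
  simp only [momentScale, dividedPow, Nat.centralBinom_zero, pow_succ]
  field_simp
  simp

lemma cosMoment_succ_eq_integral (b n : ℕ) :
    cosMoment b (n + 1) = (n + 1) *
      ∫ x in (0 : ℝ)..(π / 2), dividedPow (2 * b + 1) x * (cos x ^ (2 * n + 1) * sin x) := by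
  have hd : ∀ x, HasDerivAt (fun x => 1 / 2 * (dividedPow (2 * b + 1) x * cos x ^ (2 * n + 1 + 1)))
      (dividedPow (2 * b) x * cos x ^ (2 * (n + 1)) -
        (n + 1) * (dividedPow (2 * b + 1) x * (cos x ^ (2 * n + 1) * sin x))) x := fun x => by
    refine (((hasDerivAt_dividedPow_succ (2 * b) x).mul
      (hasDerivAt_cos_pow (2 * n + 1) x)).const_mul _).congr_deriv ?_
    push_cast
    ring
  have hi1 := intervalIntegrable_dividedPow_mul_cos (2 * b) (2 * (n + 1))
  have hi2 : IntervalIntegrable (fun x => (n + 1 : ℝ) *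
      (dividedPow (2 * b + 1) x * (cos x ^ (2 * n + 1) * sin x))) volume 0 (π / 2) := by
    have := continuous_dividedPow (2 * b + 1)
    exact Continuous.intervalIntegrable (by fun_prop) _ _
  have h := intervalIntegral.integral_eq_sub_of_hasDerivAt (a := 0) (b := π / 2)
    (fun x _ => hd x) (hi1.sub hi2)
  rw [intervalIntegral.integral_sub hi1 hi2, intervalIntegral.integral_const_mul, cos_pi_div_two,
    dividedPow_succ_apply_zero, zero_pow (Nat.succ_ne_zero _)] at h
  unfold cosMoment
  linarith

lemma scaled_cosMoment_div_cube (b n : ℕ) :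
    1 / (n : ℝ) ^ 3 * (momentScale n * cosMoment b n) =
      2 / π * ∫ x in (0 : ℝ)..(π / 2), 1 / (n : ℝ) ^ 2 * sinPow n (π / 2 - x) *
        (dividedPow (2 * b + 1) x * (sin x / cos x)) := by
  cases n with
  | zero => simp
  | succ n =>
    have h2 : ((n + 1).centralBinom : ℝ) ≠ 0 := by exact_mod_cast (n + 1).centralBinom_ne_zero
    have hintegrand : ∀ x, 1 / ((n + 1 : ℕ) : ℝ) ^ 2 * sinPow (n + 1) (π / 2 - x) *
        (dividedPow (2 * b + 1) x * (sin x / cos x)) =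
        4 ^ (n + 1) / (((n + 1 : ℕ) : ℝ) ^ 2 * (n + 1).centralBinom) *
          (dividedPow (2 * b + 1) x * (cos x ^ (2 * n + 1) * sin x)) := by
      intro x
      unfold sinPow
      rw [sin_pi_div_two_sub, mul_pow, pow_mul 2 2 (n + 1), show ((2 : ℝ) ^ 2) = 4 by norm_num,
        show 2 * (n + 1) = 2 * n + 1 + 1 by ring, pow_succ (cos x)]
      rcases eq_or_ne (cos x) 0 with hc | hc
      · rw [hc, zero_pow (Nat.succ_ne_zero _)]; ring
      · field_simp
    simp only [hintegrand]
    rw [intervalIntegral.integral_const_mul, cosMoment_succ_eq_integral]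
    unfold momentScale
    push_cast
    field_simp

lemma intervalIntegrable_mul_cot {Q : ℝ → ℝ} (hQ : Continuous Q) :
    IntervalIntegrable (fun y => y * Q y * (cos (y / 2) / sin (y / 2))) volume 0 π := by
  have hne : ∀ y ∈ Set.uIcc 0 π, sinc (y / 2) ≠ 0 := by
    intro y hy
    rw [Set.uIcc_of_le pi_pos.le] at hy
    rcases hy.1.eq_or_lt with rfl | h0
    · simp
    · rw [sinc_of_ne_zero (by positivity)]
      exact (div_pos (sin_pos_of_pos_of_lt_pi (by linarith) (by linarith [hy.2, pi_pos]))
        (by positivity)).ne'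
  have hc : ContinuousOn (fun y => 2 * (Q y * cos (y / 2)) / sinc (y / 2)) (Set.uIcc 0 π) := by
    refine ContinuousOn.div (by fun_prop) ?_ hne
    exact (continuous_sinc.comp (continuous_id.div_const 2)).continuousOn
  refine hc.intervalIntegrable.congr fun y hy => ?_
  rw [Set.uIoc_of_le pi_pos.le] at hy
  have h0 : y ≠ 0 := hy.1.ne'
  have hs : sin (y / 2) ≠ 0 :=
    (sin_pos_of_pos_of_lt_pi (by linarith [hy.1]) (by linarith [hy.2, pi_pos])).ne'
  rw [sinc_of_ne_zero (by positivity)]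
  field_simp

open Polynomial in
/-- The polynomial `(π - y)^p y^q / (p! q!)`. -/
noncomputable def momentPoly (p q : ℕ) : ℝ[X] :=
  C (1 / (p.factorial * q.factorial : ℝ)) * ((C π - X) ^ p * X ^ q)

lemma eval_momentPoly (p q : ℕ) (y : ℝ) :
    (momentPoly p q).eval y = (π - y) ^ p / p.factorial * (y ^ q / q.factorial) := by
  simp only [momentPoly, Polynomial.eval_mul, Polynomial.eval_C, Polynomial.eval_pow,
    Polynomial.eval_sub, Polynomial.eval_X]
  field_simp

open Polynomial in
lemma natDegree_momentPoly_le (p q : ℕ) : (momentPoly p q).natDegree ≤ p + q := by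
  unfold momentPoly
  compute_degree

open Polynomial in
lemma coeff_C_sub_X_pow (r : ℝ) (p k : ℕ) :
    ((C r - X) ^ p).coeff k = (-1) ^ k * r ^ (p - k) * p.choose k := by
  rcases lt_or_ge p k with h | h
  · rw [Nat.choose_eq_zero_of_lt h, coeff_eq_zero_of_natDegree_lt]
    · simp
    · refine lt_of_le_of_lt ?_ h
      compute_degree
  · have e : (C r - X : ℝ[X]) ^ p = C ((-1) ^ p) * (X + C (-r)) ^ p := by
      rw [C_pow, ← mul_pow]
      congr 1
      simp
      ring
    rw [e, coeff_C_mul, coeff_X_add_C_pow, neg_pow r]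
    obtain ⟨d, rfl⟩ := Nat.exists_eq_add_of_le h
    rw [Nat.add_sub_cancel_left, pow_add]
    have : (-1 : ℝ) ^ d * (-1) ^ d = 1 := by rw [← mul_pow]; simp
    linear_combination ((-1 : ℝ) ^ k * r ^ d * (k + d).choose k) * this

open Polynomial in
lemma eval_zero_iterate_derivative_momentPoly {p q m : ℕ} (hm : m ≤ p + q) :
    (derivative^[m] (momentPoly p q)).eval 0 =
      (-1) ^ (m - q) * m.choose q * (π ^ (p + q - m) / (p + q - m).factorial) := by
  rw [← coeff_zero_eq_eval_zero, coeff_iterate_derivative, zero_add, Nat.descFactorial_self,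
    momentPoly, coeff_C_mul, coeff_mul_X_pow']
  split_ifs with h
  · obtain ⟨k, rfl⟩ := Nat.exists_eq_add_of_le h
    obtain ⟨d, rfl⟩ : ∃ d, p = k + d := Nat.exists_eq_add_of_le (by omega)
    rw [Nat.add_sub_cancel_left, coeff_C_sub_X_pow, Nat.add_sub_cancel_left,
      show k + d + q - (q + k) = d by omega, Nat.cast_add_choose, Nat.cast_add_choose, nsmul_eq_mul]
    field_simp
  · rw [Nat.choose_eq_zero_of_lt (by omega)]
    simp

open Polynomial in
lemma eval_pi_iterate_derivative (P : ℝ[X]) (j : ℕ) :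
    (derivative^[2 * j] P).eval π = (derivative^[2 * j] (P.comp (C π - X))).eval 0 := by
  have h : derivative^[2 * j] (P.comp (C π - X)) = (derivative^[2 * j] P).comp (C π - X) := by
    induction j generalizing P with
    | zero => simp
    | succ j ih =>
      rw [Nat.mul_succ, Function.iterate_add_apply, Function.iterate_add_apply, ← ih]
      congr 1
      simp [derivative_comp]
  rw [h]
  simp

open Polynomial in
lemma momentPoly_comp (p q : ℕ) : (momentPoly p q).comp (C π - X) = momentPoly q p := by
  unfold momentPoly
  simp only [mul_comp, C_comp, pow_comp, sub_comp, X_comp, sub_sub_cancel]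
  rw [mul_comm (p.factorial : ℝ), mul_comm (X ^ p)]

lemma dividedPow_mul_eq_momentPoly (a b : ℕ) (x : ℝ) :
    dividedPow (2 * a + 2) (π / 2 - x) * (dividedPow (2 * b + 1) x * (sin x / cos x)) =
      (momentPoly (2 * b + 1) (2 * a + 2)).eval (π - 2 * x) *
        (cos ((π - 2 * x) / 2) / sin ((π - 2 * x) / 2)) := by
  rw [eval_momentPoly, show (π - 2 * x) / 2 = π / 2 - x by ring, cos_pi_div_two_sub,
    sin_pi_div_two_sub]
  unfold dividedPow
  ring

lemma intervalIntegrable_momentPoly_mul_cot (a b : ℕ) :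
    IntervalIntegrable (fun y => (momentPoly (2 * b + 1) (2 * a + 2)).eval y *
      (cos (y / 2) / sin (y / 2))) volume 0 π := by
  have h := intervalIntegrable_mul_cot
    (Q := fun y => (π - y) ^ (2 * b + 1) / (2 * b + 1).factorial *
      (y ^ (2 * a + 1) / (2 * a + 2).factorial)) (by fun_prop)
  refine h.congr fun y _ => ?_
  rw [eval_momentPoly]
  ring

/-- The value of `ζ(2, …, 2, 3, 2, …, 2)` as an integral against a cotangent. -/
lemma hasSum_truncTwos_mul_cosMoment (a b : ℕ) :
    HasSum (fun n : ℕ => truncTwos a n * (1 / (n : ℝ) ^ 3) * (momentScale n * cosMoment b n))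
      (1 / π * ∫ y in (0 : ℝ)..π, (momentPoly (2 * b + 1) (2 * a + 2)).eval y *
        (cos (y / 2) / sin (y / 2))) := by
  set G : ℝ → ℝ := fun y => (momentPoly (2 * b + 1) (2 * a + 2)).eval y *
        (cos (y / 2) / sin (y / 2)) with hG
  have hcv : ∫ x in (0 : ℝ)..(π / 2), G (π - 2 * x) = 1 / 2 * ∫ y in (0 : ℝ)..π, G y := by
    rw [intervalIntegral.integral_comp_sub_mul G two_ne_zero]
    simp [mul_div_cancel₀]
  have hGi : IntervalIntegrable (fun x => G (π - 2 * x)) volume 0 (π / 2) := by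
    have h1 := (intervalIntegrable_momentPoly_mul_cot a b).comp_sub_left π
    have h2 := h1.comp_mul_left (c := 2)
    simpa using h2.symm
  set F : ℕ → ℝ → ℝ := fun n x => truncTwos a n * (1 / (n : ℝ) ^ 2 * sinPow n (π / 2 - x) *
        (dividedPow (2 * b + 1) x * (sin x / cos x))) with hF
  have hsum : ∀ x ∈ Set.uIoc 0 (π / 2), HasSum (fun n => F n x) (G (π - 2 * x)) := by
    intro x hx
    rw [Set.uIoc_of_le (by positivity)] at hx
    have h := (hasSum_truncTwos_mul_sinPow a (u := π / 2 - x) (by linarith [hx.2])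
      (by linarith [hx.1])).mul_right (dividedPow (2 * b + 1) x * (sin x / cos x))
    rw [dividedPow_mul_eq_momentPoly] at h
    exact h.congr_fun fun n => by simp only [hF]; ring
  have hnn : ∀ n, ∀ x ∈ Set.uIoc 0 (π / 2), 0 ≤ F n x := by
    intro n x hx
    rw [Set.uIoc_of_le (by positivity)] at hx
    have hs : 0 ≤ sin x := sin_nonneg_of_nonneg_of_le_pi hx.1.le (by linarith [hx.2, pi_pos])
    have hc : 0 ≤ cos x := cos_nonneg_of_mem_Icc ⟨by linarith [hx.1, pi_pos], hx.2⟩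
    exact mul_nonneg (truncTwos_nonneg _ _) (mul_nonneg
      (mul_nonneg (by positivity) (sinPow_nonneg _ _))
      (mul_nonneg (dividedPow_nonneg _ hx.1.le) (div_nonneg hs hc)))
  have hmain : HasSum (fun n => ∫ x in (0 : ℝ)..(π / 2), F n x)
      (∫ x in (0 : ℝ)..(π / 2), G (π - 2 * x)) := by
    refine intervalIntegral.hasSum_integral_of_dominated_convergence F (fun n => ?_) (fun n => ?_)
      ?_ ?_ (ae_of_all _ hsum)
    · have h1 := (continuous_sinPow n).measurable
      have h2 := (continuous_dividedPow (2 * b + 1)).measurable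
      exact Measurable.aestronglyMeasurable (by fun_prop)
    · exact ae_of_all _ fun x hx => (norm_of_nonneg (hnn n x hx)).le
    · exact ae_of_all _ fun x hx => (hsum x hx).summable
    · exact hGi.congr fun x hx => (hsum x hx).tsum_eq.symm
  rw [hcv] at hmain
  have h := hmain.mul_left (2 / π)
  rw [show 2 / π * (1 / 2 * ∫ y in (0 : ℝ)..π, G y) = 1 / π * ∫ y in (0 : ℝ)..π, G y by ring] at h
  refine h.congr_fun fun n => ?_
  rw [mul_assoc, scaled_cosMoment_div_cube, hF, intervalIntegral.integral_const_mul]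
  ring

lemma mzv_three_eq_integral (a b : ℕ) :
    mzv (fun i : Fin (a + b + 1) => if (i : ℕ) = a then 3 else 2) =
      1 / π * ∫ y in (0 : ℝ)..π, (momentPoly (2 * b + 1) (2 * a + 2)).eval y *
        (cos (y / 2) / sin (y / 2)) := by
  have h := hasSum_truncTwos_mul_cosMoment a b
  have hnn : ∀ n : ℕ, 0 ≤ truncTwos a n * (1 / (n : ℝ) ^ 3) * (momentScale n * cosMoment b n) :=
    fun n => mul_nonneg (mul_nonneg (truncTwos_nonneg _ _) (by positivity))
      (mul_nonneg (momentScale_pos _).le (cosMoment_nonneg _ _))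
  rw [← toReal_mzvTail_zero, mzvTail_three_eq_tsum, ← h.tsum_eq,
    ← ENNReal.toReal_ofReal (tsum_nonneg hnn), ENNReal.ofReal_tsum_of_nonneg hnn h.summable]
  congr 1
  refine tsum_congr fun n => ?_
  rw [mzvTail_twos, ← ENNReal.ofReal_mul (mul_nonneg (truncTwos_nonneg _ _) (by positivity))]

theorem zagier_evaluation (a b : ℕ) :
    mzv (fun i : Fin (a + b + 1) => if (i : ℕ) = a then 3 else 2) =
      2 * ∑ r ∈ Finset.Icc 1 (a + b + 1),
        (-1 : ℝ) ^ r *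
          ((Nat.choose (2 * r) (2 * a + 2) : ℝ) -
            (1 - 1 / 2 ^ (2 * r)) * (Nat.choose (2 * r) (2 * b + 1) : ℝ)) *
          riemannZetaReal (2 * r + 1) * mzv (fun _ : Fin (a + b + 1 - r) => 2) := by
  rw [mzv_three_eq_integral, integral_polynomial_mul_cot (a + b + 1) _
    ((natDegree_momentPoly_le _ _).trans (by omega)) (by simp [eval_momentPoly])
    (by simp [eval_momentPoly]) (intervalIntegrable_momentPoly_mul_cot a b), mul_left_comm,
    Finset.mul_sum]
  congr 1
  refine Finset.sum_congr rfl fun r hr => ?_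
  obtain ⟨-, hr⟩ := Finset.mem_Icc.1 hr
  rw [eval_pi_iterate_derivative, momentPoly_comp,
    eval_zero_iterate_derivative_momentPoly (by omega),
    eval_zero_iterate_derivative_momentPoly (by omega), mzv_twos,
    show 2 * b + 1 + (2 * a + 2) - 2 * r = 2 * (a + b + 1 - r) + 1 by omega,
    show 2 * a + 2 + (2 * b + 1) - 2 * r = 2 * (a + b + 1 - r) + 1 by omega]
  have h1 : (-1 : ℝ) ^ (2 * r - (2 * a + 2)) = 1 :=
    Even.neg_one_pow (by rw [show 2 * r - (2 * a + 2) = 2 * (r - (a + 1)) by omega]; simp)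
  have h2 : (-1 : ℝ) ^ (2 * r - (2 * b + 1)) * (2 * r).choose (2 * b + 1) =
      -((2 * r).choose (2 * b + 1) : ℝ) := by
    rcases lt_or_ge (2 * r) (2 * b + 1) with h | h
    · simp [Nat.choose_eq_zero_of_lt h]
    · rw [Odd.neg_one_pow ⟨r - b - 1, by omega⟩]
      ring
  rw [h1, h2, pow_succ π]
  field_simp
  ring
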